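/- arXiv:1801.05318 — 2 statements merged into one kernel-verified Lean document; each statement's English description precedes it below -/
import Mathlib

section
/- If v is a strong support vertex of a graph G with leaf neighbors u and w, then there exists a minimum path cover of G containing the path u–v–w. -/
/-- The forcing process: vertices that eventually get colored starting from `S`.
A colored vertex with exactly one uncolored neighbor forces that neighbor. -/
inductive SimpleGraph.Forced {V : Type*} (G : SimpleGraph V) (S : Set V) : V → Prop
  | init (v : V) (hv : v ∈ S) : SimpleGraph.Forced G S v
  | force (u w : V) (hu : SimpleGraph.Forced G S u) (hadj : G.Adj u w)
      (huniq : ∀ x, G.Adj u x → x ≠ w → SimpleGraph.Forced G S x) :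
      SimpleGraph.Forced G S w

/-- `S` is a zero forcing set if the forcing process colors every vertex. -/
def SimpleGraph.IsZeroForcingSet {V : Type*} (G : SimpleGraph V) (S : Set V) : Prop :=
  ∀ v, G.Forced S v

/-- The zero forcing number `Z(G)`. -/
noncomputable def SimpleGraph.zeroForcingNumber {V : Type*} (G : SimpleGraph V) : ℕ :=
  sInf {n | ∃ S : Set V, G.IsZeroForcingSet S ∧ S.ncard = n}

/-- A total forcing set: a zero forcing set inducing a subgraph without isolated vertices. -/
def SimpleGraph.IsTotalForcingSet {V : Type*} (G : SimpleGraph V) (S : Set V) : Prop :=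
  G.IsZeroForcingSet S ∧ ∀ v ∈ S, ∃ u ∈ S, G.Adj v u

/-- The total forcing number `F_t(G)`. -/
noncomputable def SimpleGraph.totalForcingNumber {V : Type*} (G : SimpleGraph V) : ℕ :=
  sInf {n | ∃ S : Set V, G.IsTotalForcingSet S ∧ S.ncard = n}

/-- A set of vertices that is the vertex set of a path (as a subgraph) of `G`. -/
def SimpleGraph.IsPathSet {V : Type*} (G : SimpleGraph V) (P : Set V) : Prop :=
  ∃ (u v : V) (w : G.Walk u v), w.IsPath ∧ {x | x ∈ w.support} = P

/-- A path cover: a collection of vertex-disjoint paths partitioning the vertex set. -/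
def SimpleGraph.IsPathCover {V : Type*} (G : SimpleGraph V) (P : Set (Set V)) : Prop :=
  (∀ Q ∈ P, G.IsPathSet Q) ∧ P.PairwiseDisjoint id ∧ ⋃₀ P = Set.univ

/-- The path cover number `pc(G)`. -/
noncomputable def SimpleGraph.pathCoverNumber {V : Type*} (G : SimpleGraph V) : ℕ :=
  sInf {n | ∃ P : Set (Set V), G.IsPathCover P ∧ P.ncard = n}

/-- The matching number `α'(G)`. -/
noncomputable def SimpleGraph.matchingNumber {V : Type*} (G : SimpleGraph V) : ℕ :=
  sSup {n | ∃ M : G.Subgraph, M.IsMatching ∧ M.edgeSet.ncard = n}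

/-- A leaf is a vertex with exactly one neighbor. -/
def SimpleGraph.IsLeaf {V : Type*} (G : SimpleGraph V) (v : V) : Prop :=
  (G.neighborSet v).ncard = 1

namespace SimpleGraph

variable {V : Type*} {G : SimpleGraph V}

theorem isPathSet_iff_exists_list {Q : Set V} :
    G.IsPathSet Q ↔ ∃ l : List V, l ≠ [] ∧ l.IsChain G.Adj ∧ l.Nodup ∧ {x | x ∈ l} = Q := by
  constructor
  · rintro ⟨a, b, p, hp, rfl⟩
    exact ⟨p.support, p.support_ne_nil, p.isChain_adj_support, hp.support_nodup, rfl⟩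
  · rintro ⟨l, hne, hc, hn, rfl⟩
    refine ⟨_, _, Walk.ofSupport l hne hc, ?_, ?_⟩
    · rw [Walk.isPath_def, Walk.support_ofSupport]
      exact hn
    · rw [Walk.support_ofSupport]

theorem IsLeaf.eq_of_adj {u v x : V} (hu : G.IsLeaf u) (hv : G.Adj u v) (hx : G.Adj u x) :
    x = v := by
  obtain ⟨a, ha⟩ := Set.ncard_eq_one.mp hu
  have h : ∀ y, G.Adj u y → y = a := fun y hy => by
    have : y ∈ G.neighborSet u := hy
    rwa [ha] at this
  rw [h x hx, h v hv]

/-- A path through a pendant vertex `w` that avoids its neighbor `v` is trivial. -/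
theorem eq_singleton_of_isChain_of_notMem {v w : V} {l : List V}
    (hw : ∀ x, G.Adj w x → x = v) (hc : l.IsChain G.Adj) (hwl : w ∈ l) (hvl : v ∉ l) :
    l = [w] := by
  obtain ⟨s, t, rfl⟩ := List.append_of_mem hwl
  have ht : t = [] := by
    cases t with
    | nil => rfl
    | cons x t =>
      have := hw x (List.isChain_append_cons_cons.mp hc).2.1
      simp [this] at hvl
  have hs : s = [] := by
    rcases List.eq_nil_or_concat s with rfl | ⟨s, x, rfl⟩
    · rfl
    · rw [List.concat_eq_append, List.append_assoc, List.singleton_append] at hc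
      have := hw x (List.isChain_append_cons_cons.mp hc).2.1.symm
      simp [this] at hvl
  rw [hs, ht, List.nil_append]

/-- A path starting at `v` that contains a pendant neighbor `w` of `v` is the edge `vw`. -/
theorem eq_singleton_of_isChain_cons {v w : V} {l : List V}
    (hw : ∀ x, G.Adj w x → x = v) (hc : (v :: l).IsChain G.Adj) (hn : (v :: l).Nodup)
    (hwl : w ∈ l) : l = [w] :=
  eq_singleton_of_isChain_of_notMem hw hc.of_cons hwl (List.nodup_cons.mp hn).1

theorem isPathCover_range_singleton :
    G.IsPathCover (Set.range fun x : V => ({x} : Set V)) := by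
  refine ⟨?_, ?_, ?_⟩
  · rintro _ ⟨x, rfl⟩
    exact isPathSet_iff_exists_list.mpr ⟨[x], by simp, by simp, by simp, by simp⟩
  · rintro _ ⟨x, rfl⟩ _ ⟨y, rfl⟩ hxy
    have : x ≠ y := fun h => hxy (by rw [h])
    simpa [Function.onFun] using this
  · ext x
    simp

/-- Replacing some paths of a cover by disjoint paths with the same union gives a cover. -/
theorem IsPathCover.replace {P R S : Set (Set V)} (hP : G.IsPathCover P) (hR : R ⊆ P)
    (hS : ∀ Q ∈ S, G.IsPathSet Q) (hd : S.PairwiseDisjoint id) (hU : ⋃₀ S = ⋃₀ R) :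
    G.IsPathCover ((P \ R) ∪ S) := by
  have hcross : ∀ A ∈ P \ R, ∀ B ∈ S, Disjoint A B := by
    intro A hA B hB
    have : Disjoint A (⋃₀ R) := Set.disjoint_sUnion_right.mpr fun C hC =>
      hP.2.1 hA.1 (hR hC) fun h => hA.2 (h ▸ hC)
    exact this.mono_right (hU ▸ Set.subset_sUnion_of_mem hB)
  refine ⟨?_, ?_, ?_⟩
  · rintro Q (hQ | hQ)
    · exact hP.1 Q hQ.1
    · exact hS Q hQ
  · rintro A (hA | hA) B (hB | hB) hAB
    · exact hP.2.1 hA.1 hB.1 hAB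
    · exact hcross A hA B hB
    · exact (hcross B hB A hA).symm
    · exact hd hA hB hAB
  · rw [Set.sUnion_union, hU, ← Set.sUnion_union, Set.sdiff_union_of_subset hR, hP.2.2]

/-- A path cover can be modified, without increasing its size, so that a path through `v`
is cut after `v` and continued to a pendant neighbor `w` of `v`. -/
theorem IsPathCover.exists_append_leaf [Finite V] {P : Set (Set V)} {v w : V} {l₁ l₂ : List V}
    (hP : G.IsPathCover P) (hvw : G.Adj v w) (hw : ∀ x, G.Adj w x → x = v)
    (hc : (l₁ ++ v :: l₂).IsChain G.Adj) (hn : (l₁ ++ v :: l₂).Nodup)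
    (hQ : {x | x ∈ l₁ ++ v :: l₂} ∈ P) (hwl : w ∉ l₁) :
    ∃ P' : Set (Set V), G.IsPathCover P' ∧ P'.ncard ≤ P.ncard ∧
      {x | x ∈ l₁ ++ [v, w]} ∈ P' ∧ (l₁ ++ [v, w]).IsChain G.Adj ∧ (l₁ ++ [v, w]).Nodup := by
  obtain ⟨hc₁, hc₂⟩ := List.isChain_split.mp hc
  have hn₂ : (v :: l₂).Nodup := (List.nodup_append.mp hn).2.1
  have hne : v ≠ w := hvw.ne
  have hc' : (l₁ ++ [v, w]).IsChain G.Adj :=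
    List.isChain_append_cons_cons.mpr ⟨hc₁, hvw, by simp⟩
  have hn' : (l₁ ++ [v, w]).Nodup := by grind
  by_cases hwl₂ : w ∈ l₂
  · obtain rfl := eq_singleton_of_isChain_cons hw hc₂ hn₂ hwl₂
    exact ⟨P, hP, le_rfl, hQ, hc', hn'⟩
  have hwQ : w ∉ ({x | x ∈ l₁ ++ v :: l₂} : Set V) := by
    simp [hwl, hwl₂, hne.symm]
  have hwP : ({w} : Set V) ∈ P := by
    obtain ⟨A, hA, hwA⟩ : w ∈ ⋃₀ P := hP.2.2 ▸ Set.mem_univ w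
    have hvA : v ∉ A := fun hv =>
      Set.disjoint_left.mp (hP.2.1 hA hQ fun h => hwQ (h ▸ hwA)) hv (by simp)
    obtain ⟨l, -, hlc, -, rfl⟩ := isPathSet_iff_exists_list.mp (hP.1 A hA)
    obtain rfl := eq_singleton_of_isChain_of_notMem hw hlc hwA hvA
    simpa using hA
  have hR : ({{x | x ∈ l₁ ++ v :: l₂}, {w}} : Set (Set V)) ⊆ P :=
    Set.pair_subset hQ hwP
  have hRcard : ({{x | x ∈ l₁ ++ v :: l₂}, {w}} : Set (Set V)).ncard = 2 :=
    Set.ncard_pair fun h => hwQ (h ▸ rfl)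
  have hdisj : Disjoint ({x | x ∈ l₁ ++ [v, w]} : Set V) {x | x ∈ l₂} := by
    rw [Set.disjoint_left]
    intro x hx hx'
    simp only [Set.mem_ofPred_eq] at hx hx'
    grind
  have hScard : (({{x | x ∈ l₁ ++ [v, w]}, {x | x ∈ l₂}} : Set (Set V)) \ {∅}).ncard ≤ 2 :=
    (Set.ncard_le_ncard Set.sdiff_subset).trans (Set.ncard_insert_le _ _ |>.trans (by simp))
  refine ⟨(P \ {{x | x ∈ l₁ ++ v :: l₂}, {w}}) ∪
      (({{x | x ∈ l₁ ++ [v, w]}, {x | x ∈ l₂}} : Set (Set V)) \ {∅}),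
    hP.replace hR ?_ ?_ ?_, ?_, Or.inr ⟨by simp, ?_⟩, hc', hn'⟩
  · rintro Q ⟨rfl | rfl, hQne⟩
    · exact isPathSet_iff_exists_list.mpr ⟨_, by simp, hc', hn', rfl⟩
    · refine isPathSet_iff_exists_list.mpr ⟨l₂, ?_, hc₂.of_cons, hn₂.of_cons, rfl⟩
      rintro rfl
      simp at hQne
  · refine Set.PairwiseDisjoint.subset ?_ Set.sdiff_subset
    exact Set.pairwise_pair.mpr fun _ => ⟨hdisj, hdisj.symm⟩
  · rw [Set.sUnion_sdiff_singleton_empty, Set.sUnion_pair, Set.sUnion_pair]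
    ext x
    simp
    tauto
  · have h₁ := Set.ncard_union_le (P \ {{x | x ∈ l₁ ++ v :: l₂}, {w}})
      (({{x | x ∈ l₁ ++ [v, w]}, {x | x ∈ l₂}} : Set (Set V)) \ {∅})
    have h₂ := Set.ncard_sdiff_add_ncard_of_subset hR
    omega
  · intro h
    have : v ∈ ({x | x ∈ l₁ ++ [v, w]} : Set V) := by simp
    rw [h] at this
    exact this

theorem IsPathCover.pathCoverNumber_le {P : Set (Set V)} (hP : G.IsPathCover P) :
    G.pathCoverNumber ≤ P.ncard :=
  Nat.sInf_le ⟨P, hP, rfl⟩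

theorem exists_isPathCover_ncard_eq (G : SimpleGraph V) :
    ∃ P : Set (Set V), G.IsPathCover P ∧ P.ncard = G.pathCoverNumber :=
  Nat.sInf_mem (s := {n | ∃ P : Set (Set V), G.IsPathCover P ∧ P.ncard = n})
    ⟨_, _, isPathCover_range_singleton, rfl⟩

end SimpleGraph

theorem stmt9 {V : Type*} [Fintype V] (G : SimpleGraph V) (v u w : V)
    (huw : u ≠ w) (hu : G.Adj v u) (hw : G.Adj v w)
    (hlu : G.IsLeaf u) (hlw : G.IsLeaf w) :
    ∃ P : Set (Set V), G.IsPathCover P ∧ P.ncard = G.pathCoverNumber ∧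
      ({u, v, w} : Set V) ∈ P := by
  obtain ⟨P, hP, hPcard⟩ := G.exists_isPathCover_ncard_eq
  have hu' : ∀ x, G.Adj u x → x = v := fun x hx => hlu.eq_of_adj hu.symm hx
  have hw' : ∀ x, G.Adj w x → x = v := fun x hx => hlw.eq_of_adj hw.symm hx
  obtain ⟨Q, hQ, hvQ⟩ : v ∈ ⋃₀ P := hP.2.2 ▸ Set.mem_univ v
  obtain ⟨l, -, hc, hn, rfl⟩ := SimpleGraph.isPathSet_iff_exists_list.mp (hP.1 Q hQ)
  obtain ⟨l₁, l₂, rfl⟩ := List.append_of_mem hvQ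
  have hrev : ∀ {l : List V}, l.IsChain G.Adj → l.reverse.IsChain G.Adj := fun h =>
    List.isChain_reverse.mpr (h.imp fun _ _ hab => hab.symm)
  have hstep : ∃ (P₁ : Set (Set V)) (l : List V), G.IsPathCover P₁ ∧ P₁.ncard ≤ P.ncard ∧
      {x | x ∈ l ++ [v, u]} ∈ P₁ ∧ (l ++ [v, u]).IsChain G.Adj ∧ (l ++ [v, u]).Nodup := by
    by_cases hul : u ∈ l₁
    · have heq : (l₁ ++ v :: l₂).reverse = l₂.reverse ++ v :: l₁.reverse := by simp
      have hu₂ : u ∉ l₂.reverse := by grind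
      obtain ⟨P₁, h⟩ := hP.exists_append_leaf (l₁ := l₂.reverse) (l₂ := l₁.reverse) hu hu'
        (heq ▸ hrev hc) (heq ▸ List.nodup_reverse.mpr hn)
        (by simpa only [← heq, List.mem_reverse] using hQ) hu₂
      exact ⟨P₁, _, h⟩
    · obtain ⟨P₁, h⟩ := hP.exists_append_leaf hu hu' hc hn hQ hul
      exact ⟨P₁, _, h⟩
  obtain ⟨P₁, l, hP₁, hcard₁, hmem₁, hc₁, hn₁⟩ := hstep
  have heq : (l ++ [v, u]).reverse = [u] ++ v :: l.reverse := by simp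
  obtain ⟨P₂, hP₂, hcard₂, hmem₂, -, -⟩ := hP₁.exists_append_leaf hw hw' (heq ▸ hrev hc₁)
    (heq ▸ List.nodup_reverse.mpr hn₁)
    (by simpa only [← heq, List.mem_reverse] using hmem₁) (by simpa using huw.symm)
  refine ⟨P₂, hP₂, le_antisymm (by omega) hP₂.pathCoverNumber_le, ?_⟩
  convert hmem₂ using 1
  ext x
  simp
end

section
/- If a tree T has a unique minimum path cover and every path in this cover starts and ends at distinct leaves of T, then F_t(T) = 2 pc(T). -/
namespace SimpleGraph

variable {V : Type*} {G : SimpleGraph V}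

/-- A function on the vertices of a finite acyclic graph that moves along edges and never
backtracks has no nonempty invariant set. -/
theorem IsAcyclic.eq_empty_of_nonbacktracking [Fintype V] (hG : G.IsAcyclic) {R : Set V}
    (g : V → V) (hmaps : ∀ v ∈ R, g v ∈ R) (hadj : ∀ v ∈ R, G.Adj v (g v))
    (hback : ∀ v ∈ R, g (g v) ≠ v) : R = ∅ := by
  have key : ∀ n : ℕ, ∀ v ∈ R, ∃ (x : V) (p : G.Walk v x), p.IsPath ∧ p.length = n ∧
      (0 < n → p.snd = g v) := by
    intro n
    induction n with
    | zero => exact fun v _ ↦ ⟨v, .nil, by simp⟩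
    | succ n ih =>
      intro v hv
      obtain ⟨x, p, hp, hlen, hsnd⟩ := ih (g v) (hmaps v hv)
      refine ⟨x, .cons (hadj v hv) p, ?_, by simp [hlen], by simp⟩
      rw [Walk.cons_isPath_iff]
      refine ⟨hp, fun hmem ↦ ?_⟩
      have heq := hG.eq_snd_of_adj_start hp (hadj v hv).symm hmem
      rcases Nat.eq_zero_or_pos n with rfl | hn
      · cases p with
        | nil => exact (hadj v hv).ne (by simpa using hmem)
        | cons => simp at hlen
      · exact hback v hv ((heq.trans (hsnd hn)).symm)
  refine Set.eq_empty_of_forall_notMem fun v hv ↦ ?_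
  obtain ⟨x, p, hp, hlen, -⟩ := key (Fintype.card V) v hv
  exact hp.length_lt.ne hlen

/-- Suppose the vertices of a finite acyclic graph are split into paths: `π` gives the path of a
vertex, `idx` its position there and `pr` its predecessor, if it is not in first position.
Then every set containing all vertices in first position is a zero forcing set. -/
theorem IsAcyclic.isZeroForcingSet_of_path_partition [Fintype V] (hG : G.IsAcyclic) {ι : Type*}
    (π : V → ι) (idx : V → ℕ) (pr : V → V) {S : Set V}
    (hinj : ∀ u v, π u = π v → idx u = idx v → u = v)
    (hstart : ∀ v, idx v = 0 → v ∈ S)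
    (hpr : ∀ v, idx v ≠ 0 → G.Adj (pr v) v ∧ π (pr v) = π v ∧ idx (pr v) + 1 = idx v) :
    G.IsZeroForcingSet S := by
  classical
  let Good : V → Prop := fun v ↦ ∀ u, π u = π v → idx u ≤ idx v → G.Forced S u
  let Last : V → V → Prop := fun v v' ↦ Good v ∧ ¬ Good v' ∧ idx v' ≠ 0 ∧ pr v' = v
  have hidx : ∀ v, ¬ Good v → idx v ≠ 0 := by
    intro v hv h0
    exact hv fun u _ hu ↦ .init u (hstart u (by omega))
  have hforced : ∀ v, Good v → G.Forced S v := fun v hv ↦ hv v rfl le_rfl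
  have hnext : ∀ v v', Last v v' → ¬ G.Forced S v' := by
    rintro v v' ⟨hv, hv', h0, rfl⟩ hf
    refine hv' fun u hu hle ↦ ?_
    obtain ⟨-, hπ, hi⟩ := hpr v' h0
    rcases hle.lt_or_eq with hlt | heq
    · exact hv u (hu.trans hπ.symm) (by omega)
    · rwa [hinj u v' hu heq]
  have hother : ∀ v, ∃ z, ∀ v', Last v v' → z ≠ v' ∧ G.Adj v z ∧ ¬ Good z := by
    intro v
    by_cases hex : ∃ v', Last v v'
    · obtain ⟨v', hl⟩ := hex
      have hnf := hnext v v' hl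
      have hadj : G.Adj v v' := hl.2.2.2 ▸ (hpr v' hl.2.2.1).1
      obtain ⟨z, hz, hne, hzf⟩ : ∃ z, G.Adj v z ∧ z ≠ v' ∧ ¬ G.Forced S z := by
        by_contra! hcon
        exact hnf (.force v v' (hforced v hl.1) hadj hcon)
      refine ⟨z, fun v'' hl' ↦ ?_⟩
      obtain ⟨-, h1, h2⟩ := hpr v' hl.2.2.1
      obtain ⟨-, h3, h4⟩ := hpr v'' hl'.2.2.1
      rw [hl.2.2.2] at h1 h2
      rw [hl'.2.2.2] at h3 h4
      rw [← hinj v' v'' (h1.symm.trans h3) (by omega)]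
      exact ⟨hne, hz, fun h ↦ hzf (hforced z h)⟩
    · exact ⟨v, fun v' h ↦ (hex ⟨v', h⟩).elim⟩
  choose z hz using hother
  let g : V → V := fun v ↦ if Good v then z v else pr v
  have hg1 : ∀ v, Good v → g v = z v := fun v h ↦ if_pos h
  have hg2 : ∀ v, ¬ Good v → g v = pr v := fun v h ↦ if_neg h
  have hempty : {v | ¬ Good v ∨ ∃ v', Last v v'} = ∅ := by
    refine hG.eq_empty_of_nonbacktracking g ?_ ?_ ?_
    · intro v hv
      by_cases h : Good v
      · obtain ⟨v', hl⟩ := hv.resolve_left (not_not_intro h)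
        rw [hg1 v h]
        exact .inl (hz v v' hl).2.2
      · rw [hg2 v h]
        by_cases h' : Good (pr v)
        · exact .inr ⟨v, h', h, hidx v h, rfl⟩
        · exact .inl h'
    · intro v hv
      by_cases h : Good v
      · obtain ⟨v', hl⟩ := hv.resolve_left (not_not_intro h)
        rw [hg1 v h]
        exact (hz v v' hl).2.1
      · rw [hg2 v h]
        exact (hpr v (hidx v h)).1.symm
    · intro v hv
      by_cases h : Good v
      · obtain ⟨v', hl⟩ := hv.resolve_left (not_not_intro h)
        obtain ⟨hne, -, hb⟩ := hz v v' hl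
        rw [hg1 v h, hg2 _ hb]
        intro heq
        obtain ⟨-, h1, h2⟩ := hpr v' hl.2.2.1
        obtain ⟨-, h3, h4⟩ := hpr (z v) (hidx _ hb)
        rw [hl.2.2.2] at h1 h2
        rw [heq] at h3 h4
        exact hne (hinj _ _ (h3.symm.trans h1) (by omega))
      · rw [hg2 v h]
        by_cases h' : Good (pr v)
        · rw [hg1 _ h']
          exact (hz (pr v) v ⟨h', h, hidx v h, rfl⟩).1
        · rw [hg2 _ h']
          intro heq
          obtain ⟨-, -, h1⟩ := hpr v (hidx v h)
          obtain ⟨-, -, h2⟩ := hpr _ (hidx _ h')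
          rw [heq] at h2
          omega
  intro v
  by_contra hv
  have : v ∈ {v | ¬ Good v ∨ ∃ v', Last v v'} := .inl fun h ↦ hv (hforced v h)
  rw [hempty] at this
  exact this

/-- A total forcing set has at least as many vertices as the graph has leaves, because leaves
never need to force. -/
theorem IsTotalForcingSet.ncard_leaves_le [Fintype V] {S : Set V} (hS : G.IsTotalForcingSet S) :
    {v | G.IsLeaf v}.ncard ≤ S.ncard := by
  let IsStage : Set V → Prop := fun C ↦ S ⊆ C ∧ (∀ v ∈ C, ∃ u ∈ C, G.Adj v u) ∧
    ∃ U ⊆ C, C.ncard = S.ncard + U.ncard ∧ (∀ u ∈ U, ¬ G.IsLeaf u) ∧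
      ∀ u ∈ U, ∀ x, G.Adj u x → x ∈ C
  have hfirst : IsStage S := ⟨subset_rfl, hS.2, ∅, by simp⟩
  obtain ⟨C, hC⟩ := (Set.toFinite {C | IsStage C}).exists_maximal ⟨S, hfirst⟩
  obtain ⟨hSC, htot, U, hUC, hcard, hnl, hU⟩ := hC.prop
  have hclosed : ∀ v, G.Forced S v → v ∈ C := by
    intro v hv
    induction hv with
    | init v hv => exact hSC hv
    | force u w _ hadj _ huC ih =>
      by_contra hw
      have huU : u ∉ U := fun h ↦ hw (hU u h w hadj)
      have hleaf : ¬ G.IsLeaf u := by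
        intro hl
        obtain ⟨y, hy, hadj'⟩ := htot u huC
        obtain ⟨a, ha⟩ := Set.ncard_eq_one.mp hl
        have hya : y ∈ G.neighborSet u := hadj'
        have hwa : w ∈ G.neighborSet u := hadj
        rw [ha, Set.mem_singleton_iff] at hya hwa
        exact hw (hwa ▸ hya ▸ hy)
      have hstage : IsStage (insert w C) := by
        refine ⟨hSC.trans (Set.subset_insert _ _), ?_, insert u U, ?_, ?_, ?_, ?_⟩
        · rintro v (rfl | hv)
          · exact ⟨u, .inr huC, hadj.symm⟩
          · obtain ⟨y, hy, h⟩ := htot v hv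
            exact ⟨y, .inr hy, h⟩
        · exact Set.insert_subset (.inr huC) (hUC.trans (Set.subset_insert _ _))
        · rw [Set.ncard_insert_of_notMem hw, Set.ncard_insert_of_notMem huU]
          omega
        · rintro v (rfl | hv)
          exacts [hleaf, hnl v hv]
        · rintro v (rfl | hv) x hx
          · by_cases hxw : x = w
            · exact .inl hxw
            · exact .inr (ih x hx hxw)
          · exact .inr (hU v hv x hx)
      exact hw (hC.le_of_ge hstage (Set.subset_insert _ _) (Set.mem_insert _ _))
  have huniv : C = Set.univ := Set.eq_univ_of_forall fun v ↦ hclosed v (hS.1 v)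
  have hdisj : Disjoint {v | G.IsLeaf v} U :=
    Set.disjoint_left.mpr fun v hv hvU ↦ hnl v hvU hv
  have hle := Set.ncard_le_ncard (Set.subset_univ ({v | G.IsLeaf v} ∪ U))
  rw [Set.ncard_union_eq hdisj, ← huniv, hcard] at hle
  omega

end SimpleGraph

theorem stmt11 {V : Type*} [Fintype V] (T : SimpleGraph V) (hT : T.IsTree)
    (P : Set (Set V))
    (hPC : T.IsPathCover P) (hPmin : P.ncard = T.pathCoverNumber)
    (huniq : ∀ Q : Set (Set V), T.IsPathCover Q → Q.ncard = T.pathCoverNumber → Q = P)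
    (hends : ∀ p ∈ P, ∃ (a b : V) (w : T.Walk a b), w.IsPath ∧
        {x | x ∈ w.support} = p ∧ a ≠ b ∧ T.IsLeaf a ∧ T.IsLeaf b) :
    T.totalForcingNumber = 2 * T.pathCoverNumber := by
  have hends' : ∀ p : P, ∃ (a b : V) (w : T.Walk a b), w.IsPath ∧
      {x | x ∈ w.support} = p ∧ a ≠ b ∧ T.IsLeaf a ∧ T.IsLeaf b := fun p ↦ hends p p.2
  choose a b w hpath hsupp hne hla hlb using hends'
  have hcover : ∀ v : V, ∃ p : P, v ∈ (p : Set V) := by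
    intro v
    obtain ⟨p, hp, hv⟩ := Set.mem_sUnion.mp (hPC.2.2 ▸ Set.mem_univ v : v ∈ ⋃₀ P)
    exact ⟨⟨p, hp⟩, hv⟩
  choose π hπ using hcover
  have hsame : ∀ (p q : P) (v : V), v ∈ (p : Set V) → v ∈ (q : Set V) → p = q := by
    intro p q v hp hq
    by_contra hpq
    exact Set.disjoint_left.mp (hPC.2.1 p.2 q.2 fun h ↦ hpq (Subtype.ext h)) hp hq
  have hmem : ∀ (p : P) (v : V), v ∈ (w p).support → v ∈ (p : Set V) := by
    intro p v hv
    rw [← hsupp p]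
    exact hv
  have hπeq : ∀ (p : P) (v : V), v ∈ (w p).support → π v = p :=
    fun p v hv ↦ hsame _ _ v (hπ v) (hmem p v hv)
  have hidx : ∀ v : V, ∃ n, (w (π v)).getVert n = v ∧ n ≤ (w (π v)).length := by
    intro v
    refine SimpleGraph.Walk.mem_support_iff_exists_getVert.mp ?_
    have := hπ v
    rwa [← hsupp (π v)] at this
  choose idx hvert hlen using hidx
  have hidx_unique : ∀ (p : P) (v : V) (n : ℕ), n ≤ (w p).length → (w p).getVert n = v →
      π v = p ∧ idx v = n := by
    intro p v n hn hv
    have hp : π v = p := hπeq p v (hv ▸ (w p).getVert_mem_support n)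
    subst hp
    exact ⟨rfl, (hpath (π v)).getVert_injOn (hlen v) hn ((hvert v).trans hv.symm)⟩
  have hpos : ∀ p, 0 < (w p).length := fun p ↦
    Nat.pos_of_ne_zero fun h ↦ hne p (SimpleGraph.Walk.eq_of_length_eq_zero h)
  have hsnd : ∀ p, T.Adj (a p) ((w p).getVert 1) := by
    intro p
    simpa using (w p).adj_getVert_succ (hpos p)
  let S : Set V := Set.range a ∪ Set.range fun p ↦ (w p).getVert 1
  have hSforce : T.IsZeroForcingSet S := by
    refine hT.isAcyclic.isZeroForcingSet_of_path_partition π idx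
      (fun v ↦ (w (π v)).getVert (idx v - 1)) ?_ ?_ ?_
    · intro u v hp hi
      rw [← hvert u, ← hvert v, hp, hi]
    · intro v hv
      refine .inl ⟨π v, ?_⟩
      have := hvert v
      rwa [hv, SimpleGraph.Walk.getVert_zero] at this
    · intro v hv
      have hl := hlen v
      obtain ⟨h1, h2⟩ := hidx_unique (π v) _ (idx v - 1) (by omega) rfl
      refine ⟨?_, h1, by omega⟩
      have := (w (π v)).adj_getVert_succ (i := idx v - 1) (by omega)
      rwa [Nat.sub_add_cancel (Nat.pos_of_ne_zero hv), hvert v] at this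
  have hStotal : T.IsTotalForcingSet S := by
    refine ⟨hSforce, ?_⟩
    rintro v (⟨p, rfl⟩ | ⟨p, rfl⟩)
    · exact ⟨_, .inr ⟨p, rfl⟩, hsnd p⟩
    · exact ⟨_, .inl ⟨p, rfl⟩, (hsnd p).symm⟩
  have hrange : ∀ f : P → V, (Set.range f).ncard ≤ P.ncard := by
    intro f
    rw [← Set.image_univ]
    exact (Set.ncard_image_le (Set.toFinite _)).trans (by simp [Set.ncard_univ])
  have hScard : S.ncard ≤ 2 * P.ncard := by
    have h1 := Set.ncard_union_le (Set.range a) (Set.range fun p ↦ (w p).getVert 1)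
    have h2 := hrange a
    have h3 := hrange fun p ↦ (w p).getVert 1
    change (Set.range a ∪ Set.range fun p ↦ (w p).getVert 1).ncard ≤ _
    omega
  have hleaves : 2 * P.ncard ≤ {v | T.IsLeaf v}.ncard := by
    have hpa : ∀ p, π (a p) = p := fun p ↦ hπeq p _ (w p).start_mem_support
    have hpb : ∀ p, π (b p) = p := fun p ↦ hπeq p _ (w p).end_mem_support
    have hdisj : Disjoint (Set.range a) (Set.range b) := by
      rw [Set.disjoint_left]
      rintro _ ⟨p, rfl⟩ ⟨q, hq⟩
      have hqp : q = p := by rw [← hpb q, hq, hpa]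
      subst hqp
      exact hne q hq.symm
    have hsub : Set.range a ∪ Set.range b ⊆ {v | T.IsLeaf v} := by
      rintro _ (⟨p, rfl⟩ | ⟨p, rfl⟩)
      exacts [hla p, hlb p]
    have hle := Set.ncard_le_ncard hsub
    rw [Set.ncard_union_eq hdisj,
      Set.ncard_range_of_injective (Function.LeftInverse.injective hpa),
      Set.ncard_range_of_injective (Function.LeftInverse.injective hpb),
      Nat.card_coe_set_eq] at hle
    omega
  rw [← hPmin]
  refine le_antisymm (le_trans (Nat.sInf_le ⟨S, hStotal, rfl⟩) hScard) ?_
  obtain ⟨S', hS', hcard⟩ : T.totalForcingNumber ∈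
      {n | ∃ S : Set V, T.IsTotalForcingSet S ∧ S.ncard = n} :=
    Nat.sInf_mem ⟨_, S, hStotal, rfl⟩
  rw [← hcard]
  exact hleaves.trans hS'.ncard_leaves_le
end
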